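/- Let p ≥ 1 with 1/p + 1/q = 1, let t, λ ∈ (0,1), let a, b, c, d ≥ 0, and let α, β ∈ ℝ \ {0}. Set γ = αβ/(α+β) whenever α + β ≠ 0. If α + β > 0, then M_{p,α}^{(t,λ)}(a,b) · M_{p,β}^{(t,λ)}(c,d) ≥ M_{p,γ}^{(t,λ)}(ac, bd). If α + β < 0 and α·β < 0, then M_{p,α}^{(t,λ)}(a,b) · M_{p,β}^{(t,λ)}(c,d) ≥ min{ C_{p,λ,t}^{1/γ} · ac, D_{p,λ,t}^{1/γ} · bd }. -/

import Mathlib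

open MeasureTheory Set Filter
open scoped ENNReal Topology Classical

/-- The `L_p` coefficient `C_{p,λ,t} = (1-t)^{1/p} (1-λ)^{1/q}` (with `1/q = 1 - 1/p`). -/
noncomputable def Cc (p t l : ℝ) : ℝ := (1 - t) ^ (1/p) * (1 - l) ^ (1 - 1/p)

/-- The `L_p` coefficient `D_{p,λ,t} = t^{1/p} λ^{1/q}` (with `1/q = 1 - 1/p`). -/
noncomputable def Dd (p t l : ℝ) : ℝ := t ^ (1/p) * l ^ (1 - 1/p)

/-- The `L_p` `α`-mean `M_{p,α}^{(t,λ)}(a,b)` for finite `α`. -/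
noncomputable def Mp (p t l α a b : ℝ) : ℝ :=
  if a * b = 0 then 0
  else if α = 0 then a ^ Cc p t l * b ^ Dd p t l
  else (Cc p t l * a ^ α + Dd p t l * b ^ α) ^ (1/α)

/-- The classical `α`-mean `M_α^t(a,b)` for finite `α`. -/
noncomputable def Mmean (t α a b : ℝ) : ℝ :=
  if a * b = 0 then 0
  else if α = 0 then a ^ (1-t) * b ^ t
  else ((1-t) * a ^ α + t * b ^ α) ^ (1/α)

lemma two_term_holder {s r x₁ x₂ y₁ y₂ : ℝ} (hs : 0 < s) (hr : 0 < r) (hsr : s + r = 1)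
    (hx₁ : 0 < x₁) (hx₂ : 0 < x₂) (hy₁ : 0 < y₁) (hy₂ : 0 < y₂) :
    x₁ ^ s * y₁ ^ r + x₂ ^ s * y₂ ^ r ≤ (x₁ + x₂) ^ s * (y₁ + y₂) ^ r := by
  have hX : 0 < x₁ + x₂ := by positivity
  have hY : 0 < y₁ + y₂ := by positivity
  have h₁ := Real.geom_mean_le_arith_mean2_weighted hs.le hr.le
    (div_pos hx₁ hX).le (div_pos hy₁ hY).le hsr
  have h₂ := Real.geom_mean_le_arith_mean2_weighted hs.le hr.le
    (div_pos hx₂ hX).le (div_pos hy₂ hY).le hsr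
  rw [Real.div_rpow hx₁.le hX.le, Real.div_rpow hy₁.le hY.le] at h₁
  rw [Real.div_rpow hx₂.le hX.le, Real.div_rpow hy₂.le hY.le] at h₂
  have hXs := Real.rpow_pos_of_pos hX s
  have hYr := Real.rpow_pos_of_pos hY r
  have hsum : s * (x₁ / (x₁ + x₂)) + r * (y₁ / (y₁ + y₂))
      + (s * (x₂ / (x₁ + x₂)) + r * (y₂ / (y₁ + y₂))) = 1 := by
    field_simp
    linear_combination (x₁ + x₂) * (y₁ + y₂) * hsr
  have h := add_le_add h₁ h₂
  rw [hsum, div_mul_div_comm, div_mul_div_comm, ← add_div,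
    div_le_one (mul_pos hXs hYr)] at h
  exact h

/-- Hölder's inequality for weighted power sums with positive exponents. -/
lemma weighted_holder_of_pos {C D a b c d α β γ : ℝ} (hC : 0 < C) (hD : 0 < D)
    (ha : 0 < a) (hb : 0 < b) (hc : 0 < c) (hd : 0 < d)
    (hα : 0 < α) (hβ : 0 < β) (hγ : 0 < γ) (h : 1 / α + 1 / β = 1 / γ) :
    (C * (a * c) ^ γ + D * (b * d) ^ γ) ^ (1 / γ) ≤
      (C * a ^ α + D * b ^ α) ^ (1 / α) * (C * c ^ β + D * d ^ β) ^ (1 / β) := by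
  have hsr : γ / α + γ / β = 1 := by
    field_simp at h ⊢
    linear_combination h
  have key := two_term_holder (x₁ := C * a ^ α) (x₂ := D * b ^ α) (y₁ := C * c ^ β)
    (y₂ := D * d ^ β) (div_pos hγ hα) (div_pos hγ hβ) hsr
    (by positivity) (by positivity) (by positivity) (by positivity)
  have term : ∀ {E x y : ℝ}, 0 < E → 0 < x → 0 < y →
      (E * x ^ α) ^ (γ / α) * (E * y ^ β) ^ (γ / β) = E * (x * y) ^ γ := by
    intro E x y hE hx hy
    rw [Real.mul_rpow hE.le (by positivity), Real.mul_rpow hE.le (by positivity),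
      ← Real.rpow_mul hx.le, ← Real.rpow_mul hy.le, mul_div_cancel₀ _ hα.ne',
      mul_div_cancel₀ _ hβ.ne', Real.mul_rpow hx.le hy.le, mul_mul_mul_comm,
      ← Real.rpow_add hE, hsr, Real.rpow_one]
  rw [term hC ha hc, term hD hb hd] at key
  refine (Real.rpow_le_rpow (by positivity) key (by positivity)).trans_eq ?_
  rw [Real.mul_rpow (by positivity) (by positivity), ← Real.rpow_mul (by positivity),
    ← Real.rpow_mul (by positivity)]
  congr 2 <;> field_simp

/-- Reverse Hölder inequality for weighted power sums, with exponents of opposite sign. -/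
lemma weighted_holder_of_neg {C D a b c d α β γ : ℝ} (hC : 0 < C) (hD : 0 < D)
    (ha : 0 < a) (hb : 0 < b) (hc : 0 < c) (hd : 0 < d)
    (hα : 0 < α) (hβ : β < 0) (hγ : γ < 0) (h : 1 / α + 1 / β = 1 / γ) :
    (C * (a * c) ^ γ + D * (b * d) ^ γ) ^ (1 / γ) ≤
      (C * a ^ α + D * b ^ α) ^ (1 / α) * (C * c ^ β + D * d ^ β) ^ (1 / β) := by
  have key := weighted_holder_of_pos hC hD ha hb
    (inv_pos.2 (mul_pos ha hc)) (inv_pos.2 (mul_pos hb hd)) hα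
    (neg_pos.2 hγ) (neg_pos.2 hβ) (by
      rw [one_div_neg_eq_neg_one_div, one_div_neg_eq_neg_one_div]
      linear_combination h)
  have term : ∀ {x : ℝ} (y : ℝ), 0 < x → x⁻¹ ^ (-y) = x ^ y := by
    intro x y hx
    rw [Real.inv_rpow hx.le, Real.rpow_neg hx.le, inv_inv]
  have hac : a * (a * c)⁻¹ = c⁻¹ := by field_simp
  have hbd : b * (b * d)⁻¹ = d⁻¹ := by field_simp
  have hY : 0 < C * c ^ β + D * d ^ β := by positivity
  have hZ : 0 < C * (a * c) ^ γ + D * (b * d) ^ γ := by positivity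
  rw [hac, hbd, term _ hc, term _ hd, term _ (mul_pos ha hc), term _ (mul_pos hb hd),
    one_div_neg_eq_neg_one_div, one_div_neg_eq_neg_one_div, Real.rpow_neg hY.le,
    Real.rpow_neg hZ.le, ← div_eq_mul_inv, le_div_iff₀ (Real.rpow_pos_of_pos hZ _),
    inv_mul_le_iff₀ (Real.rpow_pos_of_pos hY _), mul_comm (_ ^ (1 / β))] at key
  exact key

lemma min_le_weighted_mul {C D a b c d α β γ : ℝ} (hC : 0 < C) (hD : 0 < D)
    (ha : 0 < a) (hb : 0 < b) (hc : 0 < c) (hd : 0 < d)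
    (hα : 0 < α) (hβ : β < 0) (hαβ : α + β < 0) (h : 1 / α + 1 / β = 1 / γ) :
    min (C ^ (1 / γ) * (a * c)) (D ^ (1 / γ) * (b * d)) ≤
      (C * a ^ α + D * b ^ α) ^ (1 / α) * (C * c ^ β + D * d ^ β) ^ (1 / β) := by
  set m := min (C ^ (1 / γ) * (a * c)) (D ^ (1 / γ) * (b * d))
  have hm : 0 < m := lt_min (by positivity) (by positivity)
  have hr : 0 ≤ -(α / β) := by
    rw [← div_neg]; exact (div_pos hα (neg_pos.2 hβ)).le
  have hr1 : -(α / β) ≤ 1 := by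
    rw [← div_neg, div_le_one (neg_pos.2 hβ)]; linarith
  have hexp : α * (1 / γ) = 1 + α / β := by
    rw [← h]; field_simp
  have term : ∀ {E x y : ℝ}, 0 < E → 0 < x → 0 < y → m ≤ E ^ (1 / γ) * (x * y) →
      m ^ α * (E * y ^ β) ^ (-(α / β)) ≤ E * x ^ α := by
    intro E x y hE hx hy hle
    have hle' := Real.rpow_le_rpow hm.le hle hα.le
    calc m ^ α * (E * y ^ β) ^ (-(α / β))
        ≤ (E ^ (1 / γ) * (x * y)) ^ α * (E * y ^ β) ^ (-(α / β)) := by gcongr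
      _ = (E ^ (1 + α / β) * E ^ (-(α / β))) * x ^ α * (y ^ α * y ^ (-α)) := by
        rw [Real.mul_rpow (by positivity) (by positivity), Real.mul_rpow hx.le hy.le,
          Real.mul_rpow hE.le (by positivity), ← Real.rpow_mul hE.le, ← Real.rpow_mul hy.le,
          mul_comm (1 / γ), hexp, mul_neg, mul_div_cancel₀ _ hβ.ne]
        ring
      _ = E * x ^ α := by
        rw [← Real.rpow_add hE, ← Real.rpow_add hy]
        simp
  have hY : 0 < C * c ^ β + D * d ^ β := by positivity
  have hX : m ^ α * (C * c ^ β + D * d ^ β) ^ (-(α / β)) ≤ C * a ^ α + D * b ^ α := by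
    refine le_trans ?_ (add_le_add (term hC ha hc (min_le_left _ _))
      (term hD hb hd (min_le_right _ _)))
    rw [← mul_add]
    gcongr
    exact Real.rpow_add_le_add_rpow (by positivity) (by positivity) hr hr1
  have key := Real.rpow_le_rpow (by positivity) hX (one_div_pos.2 hα).le
  rw [Real.mul_rpow (by positivity) (by positivity), ← Real.rpow_mul hm.le,
    ← Real.rpow_mul hY.le, mul_one_div_cancel hα.ne', Real.rpow_one,
    show -(α / β) * (1 / α) = -(1 / β) by field_simp, Real.rpow_neg hY.le, ← div_eq_mul_inv,
    div_le_iff₀ (Real.rpow_pos_of_pos hY _)] at key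
  exact key

lemma Cc_pos {p t l : ℝ} (ht : t < 1) (hl : l < 1) : 0 < Cc p t l :=
  mul_pos (Real.rpow_pos_of_pos (sub_pos.2 ht) _) (Real.rpow_pos_of_pos (sub_pos.2 hl) _)

lemma Dd_pos {p t l : ℝ} (ht : 0 < t) (hl : 0 < l) : 0 < Dd p t l :=
  mul_pos (Real.rpow_pos_of_pos ht _) (Real.rpow_pos_of_pos hl _)

lemma Mp_of_pos {p t l α a b : ℝ} (hα : α ≠ 0) (ha : 0 < a) (hb : 0 < b) :
    Mp p t l α a b = (Cc p t l * a ^ α + Dd p t l * b ^ α) ^ (1 / α) := by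
  rw [Mp, if_neg (mul_pos ha hb).ne', if_neg hα]

lemma Mp_nonneg {p t l α a b : ℝ} (hC : 0 < Cc p t l) (hD : 0 < Dd p t l)
    (ha : 0 ≤ a) (hb : 0 ≤ b) : 0 ≤ Mp p t l α a b := by
  unfold Mp
  split_ifs <;> positivity

/-- Hölder type inequality for the `L_p` `α`-means. -/
theorem stmt_0 (p t l a b c d α β : ℝ) (hp : 1 ≤ p)
    (ht : t ∈ Set.Ioo (0:ℝ) 1) (hl : l ∈ Set.Ioo (0:ℝ) 1)
    (ha : 0 ≤ a) (hb : 0 ≤ b) (hc : 0 ≤ c) (hd : 0 ≤ d)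
    (hα : α ≠ 0) (hβ : β ≠ 0) :
    (0 < α + β →
      Mp p t l α a b * Mp p t l β c d ≥ Mp p t l (α * β / (α + β)) (a * c) (b * d)) ∧
    (α + β < 0 → α * β < 0 →
      Mp p t l α a b * Mp p t l β c d ≥
        min (Cc p t l ^ (1 / (α * β / (α + β))) * (a * c))
            (Dd p t l ^ (1 / (α * β / (α + β))) * (b * d))) := by
  have hC : 0 < Cc p t l := Cc_pos ht.2 hl.2
  have hD : 0 < Dd p t l := Dd_pos ht.1 hl.1
  by_cases hpos : 0 < a ∧ 0 < b ∧ 0 < c ∧ 0 < d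
  · obtain ⟨ha', hb', hc', hd'⟩ := hpos
    rw [Mp_of_pos hα ha' hb', Mp_of_pos hβ hc' hd']
    refine ⟨fun hs ↦ ?_, fun hs hαβ ↦ ?_⟩
    · have hγ : α * β / (α + β) ≠ 0 := div_ne_zero (mul_ne_zero hα hβ) hs.ne'
      have hsum : 1 / α + 1 / β = 1 / (α * β / (α + β)) := by
        field_simp
        ring
      rw [Mp_of_pos hγ (mul_pos ha' hc') (mul_pos hb' hd'), ge_iff_le]
      rcases hα.lt_or_gt with hα' | hα'
      · have hβ' : 0 < β := by linarith
        rw [mul_comm (_ ^ (1 / α)), mul_comm a, mul_comm b]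
        exact weighted_holder_of_neg hC hD hc' hd' ha' hb' hβ' hα'
          (div_neg_of_neg_of_pos (mul_neg_of_neg_of_pos hα' hβ') hs) (by rw [add_comm, hsum])
      · rcases hβ.lt_or_gt with hβ' | hβ'
        · exact weighted_holder_of_neg hC hD ha' hb' hc' hd' hα' hβ'
            (div_neg_of_neg_of_pos (mul_neg_of_pos_of_neg hα' hβ') hs) hsum
        · exact weighted_holder_of_pos hC hD ha' hb' hc' hd' hα' hβ' (by positivity) hsum
    · have hsum : 1 / α + 1 / β = 1 / (α * β / (α + β)) := by
        have := hs.ne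
        field_simp
        ring
      rw [ge_iff_le]
      rcases mul_neg_iff.1 hαβ with ⟨hα', hβ'⟩ | ⟨hα', hβ'⟩
      · exact min_le_weighted_mul hC hD ha' hb' hc' hd' hα' hβ' hs hsum
      · rw [mul_comm (_ ^ (1 / α)), mul_comm a, mul_comm b]
        exact min_le_weighted_mul hC hD hc' hd' ha' hb' hβ' hα' (by rwa [add_comm])
          (by rw [add_comm, hsum])
  · have hzero : a * c = 0 ∨ b * d = 0 := by
      by_contra! hne
      have h₁ := mul_ne_zero_iff.1 hne.1
      have h₂ := mul_ne_zero_iff.1 hne.2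
      exact hpos ⟨ha.lt_of_ne' h₁.1, hb.lt_of_ne' h₂.1, hc.lt_of_ne' h₁.2, hd.lt_of_ne' h₂.2⟩
    have hprod : 0 ≤ Mp p t l α a b * Mp p t l β c d :=
      mul_nonneg (Mp_nonneg hC hD ha hb) (Mp_nonneg hC hD hc hd)
    refine ⟨fun _ ↦ ?_, fun _ _ ↦ ?_⟩
    · have hM : Mp p t l (α * β / (α + β)) (a * c) (b * d) = 0 := if_pos (mul_eq_zero.2 hzero)
      rwa [hM]
    · refine le_trans (min_le_iff.2 ?_) hprod
      exact hzero.imp (fun h ↦ by simp [h]) (fun h ↦ by simp [h])
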